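/- Let d ≥ 1, 1 < p < ∞, δ ∈ ℝ, let m be an integer with m > 1 + d/p, and let K ≥ 1, ε > 0. Let φ = Id + u : ℝ^d → ℝ^d be a bijective C^m map with C^m inverse such that |D^α u(x)| ≤ K for all x ∈ ℝ^d and all multi-indices α with 0 ≤ |α| ≤ m, and det Dφ(x) ≥ ε for all x. Then there exists a constant C = C(d,m,p,δ,K,ε) such that for every f ∈ C_c^∞(ℝ^d) and every integer 0 ≤ k ≤ m, ‖f∘φ‖_{H^{k,p}_δ} ≤ C · ‖f‖_{H^{k,p}_δ}. -/

import Mathlib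

open MeasureTheory Filter
open scoped BigOperators ENNReal Topology

noncomputable section

/-- The Japanese bracket `⟨x⟩ = (1+|x|²)^{1/2}`. -/
def jb {d : ℕ} (x : EuclideanSpace ℝ (Fin d)) : ℝ := Real.sqrt (1 + ‖x‖ ^ 2)

/-- The partial derivative in the `i`-th coordinate direction. -/
def pd {d : ℕ} {F : Type*} [NormedAddCommGroup F] [NormedSpace ℝ F] (i : Fin d)
    (f : EuclideanSpace ℝ (Fin d) → F) : EuclideanSpace ℝ (Fin d) → F :=
  fun x => fderiv ℝ f x (EuclideanSpace.single i 1)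

/-- Iterated partial derivatives along a list of coordinate directions. -/
def pdList {d : ℕ} {F : Type*} [NormedAddCommGroup F] [NormedSpace ℝ F] :
    List (Fin d) → (EuclideanSpace ℝ (Fin d) → F) → EuclideanSpace ℝ (Fin d) → F
  | [], f => f
  | i :: l, f => pd i (pdList l f)

/-- The partial derivative `D^α f` corresponding to a multi-index `α : Fin d → ℕ`. -/
def mD {d : ℕ} {F : Type*} [NormedAddCommGroup F] [NormedSpace ℝ F] (α : Fin d → ℕ)
    (f : EuclideanSpace ℝ (Fin d) → F) : EuclideanSpace ℝ (Fin d) → F :=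
  pdList ((List.finRange d).flatMap fun i => List.replicate (α i) i) f

/-- The order `|α|` of a multi-index. -/
def msize {d : ℕ} (α : Fin d → ℕ) : ℕ := ∑ i, α i

/-- The finset of all multi-indices on `ℝ^d` of order at most `m`. -/
def mIdx (d m : ℕ) : Finset (Fin d → ℕ) :=
  (Fintype.piFinset fun _ : Fin d => Finset.range (m + 1)).filter fun α => msize α ≤ m

section

variable {d : ℕ} {F : Type*} [NormedAddCommGroup F] [NormedSpace ℝ F]

lemma contDiff_pd {n : ℕ} {g : EuclideanSpace ℝ (Fin d) → F} (hg : ContDiff ℝ (n + 1 : ℕ) g)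
    (i : Fin d) : ContDiff ℝ n (pd i g) := by
  have h : ContDiff ℝ n (fderiv ℝ g) := hg.fderiv_right (by norm_cast)
  exact h.clm_apply contDiff_const

lemma contDiff_pdList {g : EuclideanSpace ℝ (Fin d) → F} (l : List (Fin d)) :
    ∀ {n : ℕ}, ContDiff ℝ (n + l.length : ℕ) g → ContDiff ℝ n (pdList l g) := by
  induction l with
  | nil => intro n h; simpa [pdList] using h
  | cons i l ih =>
    intro n h
    refine contDiff_pd (ih ?_) i
    have : n + 1 + l.length = n + (i :: l).length := by simp; ring
    rwa [this]

lemma pd_comm {g : EuclideanSpace ℝ (Fin d) → F} (hg : ContDiff ℝ 2 g) (i j : Fin d) :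
    pd i (pd j g) = pd j (pd i g) := by
  have hd : Differentiable ℝ (fderiv ℝ g) :=
    (hg.fderiv_right (m := 1) (by norm_num)).differentiable (by norm_num)
  have key : ∀ (a b : Fin d) (x : EuclideanSpace ℝ (Fin d)), pd a (pd b g) x =
      fderiv ℝ (fderiv ℝ g) x (EuclideanSpace.single a 1) (EuclideanSpace.single b 1) := by
    intro a b x
    unfold pd
    rw [fderiv_clm_apply (hd x) (differentiableAt_const _)]
    simp
  funext x
  rw [key, key]
  exact (hg.contDiffAt.isSymmSndFDerivAt (by simp)).eq _ _

lemma pdList_perm {g : EuclideanSpace ℝ (Fin d) → F} {l₁ l₂ : List (Fin d)} (h : l₁.Perm l₂) :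
    ContDiff ℝ (l₁.length : ℕ) g → pdList l₁ g = pdList l₂ g := by
  induction h with
  | nil => intro _; rfl
  | cons i _ ih =>
    intro hg
    simp only [pdList]
    rw [ih (hg.of_le (by simp))]
  | swap i j l =>
    intro hg
    simp only [pdList]
    refine pd_comm (contDiff_pdList l (n := 2) (hg.of_le ?_)) _ _
    norm_cast
    simp only [List.length_cons]
    omega
  | trans h₁ _ ih₁ ih₂ =>
    intro hg
    rw [ih₁ hg, ih₂ (h₁.length_eq ▸ hg)]

lemma pdList_eq_iteratedFDeriv {g : EuclideanSpace ℝ (Fin d) → F} (l : List (Fin d)) :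
    ContDiff ℝ (l.length : ℕ) g → ∀ x, pdList l g x =
      iteratedFDeriv ℝ l.length g x (fun j => EuclideanSpace.single (l.get j) 1) := by
  induction l with
  | nil => intro _ x; simp [pdList]
  | cons i l ih =>
    intro hg x
    have hg' : ContDiff ℝ (l.length : ℕ) g := hg.of_le (by simp)
    have hdiff : DifferentiableAt ℝ (iteratedFDeriv ℝ l.length g) x := by
      refine (hg.differentiable_iteratedFDeriv ?_) x
      norm_cast
      simp
    rw [show pdList (i :: l) g = pd i (pdList l g) from rfl, funext (ih hg')]
    exact (hdiff.iteratedFDeriv_succ_apply_left'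
      (m := fun j => EuclideanSpace.single ((i :: l).get j) 1)).symm

/-- The list of coordinate directions attached to a multi-index. -/
def dirs (α : Fin d → ℕ) : List (Fin d) :=
  (List.finRange d).flatMap fun i => List.replicate (α i) i

lemma length_dirs (α : Fin d → ℕ) : (dirs α).length = msize α := by
  simp [dirs, msize, List.length_flatMap, Fin.sum_univ_def]

lemma count_dirs (α : Fin d → ℕ) (j : Fin d) : (dirs α).count j = α j := by
  have : (List.map (List.count j ∘ fun i => List.replicate (α i) i) (List.finRange d)).sum
      = ∑ i, if i = j then α i else 0 := by
    rw [Fin.sum_univ_def]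
    congr 1
    refine List.map_congr_left fun i _ => ?_
    simp [List.count_replicate]
  rw [dirs, List.count_flatMap, this]
  simp

lemma sum_count (l : List (Fin d)) : msize (fun i => l.count i) = l.length := by
  rw [← length_dirs]
  exact (List.perm_iff_count.2 fun a => count_dirs _ a).length_eq

lemma mD_count {g : EuclideanSpace ℝ (Fin d) → F} (l : List (Fin d))
    (hg : ContDiff ℝ (l.length : ℕ) g) : mD (fun i => l.count i) g = pdList l g :=
  (pdList_perm (List.perm_iff_count.2 fun a => (count_dirs (fun i => l.count i) a).symm) hg).symm

lemma mem_mIdx {k : ℕ} {α : Fin d → ℕ} : α ∈ mIdx d k ↔ msize α ≤ k := by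
  simp only [mIdx, Finset.mem_filter, Fintype.mem_piFinset, Finset.mem_range, and_iff_right_iff_imp]
  intro h i
  have : α i ≤ msize α := Finset.single_le_sum (fun j _ => Nat.zero_le (α j)) (Finset.mem_univ i)
  omega

lemma mIdx_mono {k m : ℕ} (h : k ≤ m) : mIdx d k ⊆ mIdx d m := fun _ hα =>
  mem_mIdx.2 ((mem_mIdx.1 hα).trans h)

lemma norm_mD_le {n : ℕ} {g : EuclideanSpace ℝ (Fin d) → F} (hg : ContDiff ℝ n g)
    {α : Fin d → ℕ} (hα : msize α ≤ n) (x : EuclideanSpace ℝ (Fin d)) :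
    ‖mD α g x‖ ≤ ‖iteratedFDeriv ℝ (msize α) g x‖ := by
  have hg' : ContDiff ℝ ((dirs α).length : ℕ) g := hg.of_le (by rw [length_dirs]; exact_mod_cast hα)
  rw [← length_dirs, show mD α g x = pdList (dirs α) g x from rfl,
    pdList_eq_iteratedFDeriv _ hg']
  refine (ContinuousMultilinearMap.le_opNorm _ _).trans ?_
  simp

lemma continuous_mD {n : ℕ} {g : EuclideanSpace ℝ (Fin d) → F} (hg : ContDiff ℝ n g)
    {α : Fin d → ℕ} (hα : msize α ≤ n) : Continuous (mD α g) := by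
  refine (contDiff_pdList (dirs α) (n := 0) (hg.of_le ?_)).continuous
  rw [length_dirs, zero_add]
  exact_mod_cast hα

lemma hasCompactSupport_mD {g : EuclideanSpace ℝ (Fin d) → F} (hg : HasCompactSupport g)
    (α : Fin d → ℕ) : HasCompactSupport (mD α g) := by
  unfold mD
  induction (List.finRange d).flatMap fun i => List.replicate (α i) i with
  | nil => exact hg
  | cons i l ih => exact ih.fderiv_apply ℝ _

lemma opNorm_le_sum_basis {n : ℕ}
    (M : ContinuousMultilinearMap ℝ (fun _ : Fin n => EuclideanSpace ℝ (Fin d)) F) :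
    ‖M‖ ≤ ∑ r : Fin n → Fin d, ‖M fun j => EuclideanSpace.single (r j) 1‖ := by
  refine ContinuousMultilinearMap.opNorm_le_bound (by positivity) fun v => ?_
  have hv : v = fun j => ∑ i, v j i • EuclideanSpace.single i (1 : ℝ) := by
    funext j
    ext k
    simp [Finset.sum_apply, Pi.single_apply]
  have hM : M v = ∑ r : Fin n → Fin d,
      (∏ j, v j (r j)) • M fun j => EuclideanSpace.single (r j) 1 := by
    conv_lhs => rw [hv]
    rw [ContinuousMultilinearMap.map_sum]
    exact Finset.sum_congr rfl fun r _ => M.map_smul_univ _ _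
  rw [hM, Finset.sum_mul]
  refine (norm_sum_le _ _).trans (Finset.sum_le_sum fun r _ => ?_)
  rw [norm_smul, mul_comm, norm_prod]
  gcongr with j _
  exact PiLp.norm_apply_le (v j) (r j)

lemma norm_iteratedFDeriv_le_sum_mD {i k : ℕ} {g : EuclideanSpace ℝ (Fin d) → F}
    (hg : ContDiff ℝ k g) (hi : i ≤ k) (x : EuclideanSpace ℝ (Fin d)) :
    ‖iteratedFDeriv ℝ i g x‖ ≤ (d : ℝ) ^ i * ∑ β ∈ mIdx d k, ‖mD β g x‖ := by
  refine (opNorm_le_sum_basis _).trans ?_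
  have hterm : ∀ r : Fin i → Fin d,
      ‖iteratedFDeriv ℝ i g x fun j => EuclideanSpace.single (r j) 1‖ ≤
        ∑ β ∈ mIdx d k, ‖mD β g x‖ := by
    intro r
    obtain ⟨l, hl, hlr⟩ : ∃ l : List (Fin d), ∃ h : l.length = i,
        ∀ j : Fin l.length, l.get j = r (Fin.cast h j) :=
      ⟨List.ofFn r, List.length_ofFn, fun j => by simp; rfl⟩
    subst hl
    have hg' : ContDiff ℝ (l.length : ℕ) g := hg.of_le (by exact_mod_cast hi)
    have e : (iteratedFDeriv ℝ l.length g x fun j => EuclideanSpace.single (r j) 1) =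
        mD (fun i => l.count i) g x := by
      rw [mD_count l hg', pdList_eq_iteratedFDeriv l hg']
      congr 1
      funext j
      rw [hlr j]
      rfl
    rw [e]
    exact Finset.single_le_sum (f := fun β => ‖mD β g x‖) (fun _ _ => norm_nonneg _)
      (mem_mIdx.2 ((sum_count l).trans_le hi))
  refine (Finset.sum_le_sum fun r _ => hterm r).trans ?_
  simp

end

lemma norm_iteratedFDeriv_id_le {E : Type*} [NormedAddCommGroup E] [NormedSpace ℝ E] {i : ℕ}
    (hi : 1 ≤ i) (x : E) : ‖iteratedFDeriv ℝ i (fun y : E => y) x‖ ≤ 1 := by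
  obtain ⟨n, rfl⟩ : ∃ n, i = n + 1 := ⟨i - 1, by omega⟩
  rw [← norm_iteratedFDeriv_fderiv, show fderiv ℝ (fun y : E => y) =
    fun _ => ContinuousLinearMap.id ℝ E from funext fun y => fderiv_fun_id]
  rcases Nat.eq_zero_or_pos n with rfl | hn
  · simpa using ContinuousLinearMap.norm_id_le
  · rw [iteratedFDeriv_const_of_ne hn.ne']
    simp

/-- Pointwise chain rule estimate. -/
lemma exists_abs_mD_comp_le (d m : ℕ) {K : ℝ} (hK : 1 ≤ K) :
    ∃ A : ℝ, 0 < A ∧ ∀ u : EuclideanSpace ℝ (Fin d) → EuclideanSpace ℝ (Fin d),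
      ContDiff ℝ m u → (∀ α ∈ mIdx d m, ∀ x, ‖mD α u x‖ ≤ K) →
      ∀ f : EuclideanSpace ℝ (Fin d) → ℝ, ContDiff ℝ m f → ∀ k ≤ m, ∀ α ∈ mIdx d k, ∀ x,
        |mD α (fun y => f (y + u y)) x| ≤ A * ∑ β ∈ mIdx d k, |mD β f (x + u x)| := by
  set B : ℝ := (d + 1 : ℝ) ^ m with hB
  have hB1 : 1 ≤ B := one_le_pow₀ (by linarith [Nat.cast_nonneg (α := ℝ) d])
  have hdB : ∀ i ≤ m, (d : ℝ) ^ i ≤ B := fun i hi =>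
    (pow_le_pow_left₀ (by positivity) (by linarith) i).trans
      (pow_le_pow_right₀ (by linarith [Nat.cast_nonneg (α := ℝ) d]) hi)
  set D : ℝ := 1 + B * ((mIdx d m).card * K) with hD
  have hD1 : 1 ≤ D := by
    have : 0 ≤ B * ((mIdx d m).card * K) := by positivity
    linarith
  refine ⟨m.factorial * B * D ^ m, by positivity, fun u hu hbd f hf k hk α hα x => ?_⟩
  have hφ : ContDiff ℝ m (fun y => y + u y) := contDiff_id.add hu
  have hα' := mem_mIdx.1 hα
  set S := ∑ β ∈ mIdx d k, |mD β f (x + u x)| with hS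
  have hS0 : 0 ≤ S := Finset.sum_nonneg fun _ _ => abs_nonneg _
  have h1 : |mD α (fun y => f (y + u y)) x| ≤
      ‖iteratedFDeriv ℝ (msize α) (f ∘ fun y => y + u y) x‖ :=
    norm_mD_le (hf.comp hφ) (hα'.trans hk) x
  have h2 : ‖iteratedFDeriv ℝ (msize α) (f ∘ fun y => y + u y) x‖ ≤
      (msize α).factorial * (B * S) * D ^ msize α := by
    refine norm_iteratedFDeriv_comp_le hf hφ (by exact_mod_cast hα'.trans hk) x ?_ ?_
    · intro i hi
      refine (norm_iteratedFDeriv_le_sum_mD (hf.of_le (by exact_mod_cast hk))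
        (hi.trans hα') _).trans ?_
      exact mul_le_mul_of_nonneg_right (hdB i (hi.trans (hα'.trans hk))) hS0
    · intro i hi1 hi
      have him : i ≤ m := hi.trans (hα'.trans hk)
      have hui : ‖iteratedFDeriv ℝ i u x‖ ≤ B * ((mIdx d m).card * K) := by
        refine (norm_iteratedFDeriv_le_sum_mD hu him _).trans ?_
        refine mul_le_mul (hdB i him) ?_ (Finset.sum_nonneg fun _ _ => norm_nonneg _) (by positivity)
        exact (Finset.sum_le_card_nsmul _ _ K fun β hβ => hbd β hβ x).trans_eq (nsmul_eq_mul _ _)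
      have hu' : ContDiff ℝ i u := hu.of_le (by exact_mod_cast him)
      rw [fun_iteratedFDeriv_add_apply (contDiff_fun_id.contDiffAt) hu'.contDiffAt]
      refine (norm_add_le _ _).trans ?_
      have h3 := norm_iteratedFDeriv_id_le hi1 x
      calc _ ≤ D := add_le_add h3 hui
        _ ≤ D ^ i := le_self_pow₀ hD1 (by omega)
  have hfac : ((msize α).factorial : ℝ) ≤ m.factorial := by
    exact_mod_cast Nat.factorial_le (hα'.trans hk)
  have hpow : D ^ msize α ≤ D ^ m := pow_le_pow_right₀ hD1 (hα'.trans hk)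
  calc _ ≤ (msize α).factorial * (B * S) * D ^ msize α := h1.trans h2
    _ ≤ m.factorial * (B * S) * D ^ m := by gcongr
    _ = _ := by ring

lemma jb_pos {d : ℕ} (x : EuclideanSpace ℝ (Fin d)) : 0 < jb x :=
  Real.sqrt_pos.2 (by positivity)

lemma continuous_jb {d : ℕ} : Continuous (jb (d := d)) := by
  unfold jb
  fun_prop

lemma jb_add_le {d : ℕ} {K : ℝ} {x v : EuclideanSpace ℝ (Fin d)} (hv : ‖v‖ ≤ K) :
    jb (x + v) ≤ (1 + K) * jb x := by
  have hK : 0 ≤ K := (norm_nonneg v).trans hv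
  unfold jb
  rw [← Real.sqrt_sq (show 0 ≤ 1 + K by positivity), ← Real.sqrt_mul (sq_nonneg _)]
  apply Real.sqrt_le_sqrt
  have h : ‖x + v‖ ≤ ‖x‖ + K := (norm_add_le _ _).trans (by linarith)
  have h2 : ‖x + v‖ ^ 2 ≤ (‖x‖ + K) ^ 2 := by gcongr
  nlinarith [mul_nonneg hK (sq_nonneg (‖x‖ - 1)), mul_nonneg hK (sq_nonneg ‖x‖),
    mul_nonneg (sq_nonneg K) (sq_nonneg ‖x‖)]

lemma jb_rpow_le {d : ℕ} {K : ℝ} (δ : ℝ) {x v : EuclideanSpace ℝ (Fin d)} (hv : ‖v‖ ≤ K) :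
    jb x ^ δ ≤ (1 + K) ^ |δ| * jb (x + v) ^ δ := by
  have hK : 0 ≤ K := (norm_nonneg v).trans hv
  have hx := jb_pos x
  have hy := jb_pos (x + v)
  rcases le_total 0 δ with hδ | hδ
  · have h : jb x ≤ (1 + K) * jb (x + v) := by
      simpa using jb_add_le (x := x + v) (v := -v) (K := K) (by simpa using hv)
    rw [abs_of_nonneg hδ, ← Real.mul_rpow (by positivity) hy.le]
    exact Real.rpow_le_rpow hx.le h hδ
  · have h : jb (x + v) ≤ (1 + K) * jb x := jb_add_le hv
    rw [abs_of_nonpos hδ, Real.rpow_neg (by positivity), ← Real.inv_rpow (by positivity),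
      ← Real.mul_rpow (by positivity) hy.le]
    refine Real.rpow_le_rpow_of_nonpos (by positivity) ?_ hδ
    rwa [inv_mul_le_iff₀ (by positivity)]

/-- Change of variables with a lower bound for the Jacobian determinant. -/
lemma integral_comp_le_of_le_det {E : Type*} [NormedAddCommGroup E] [NormedSpace ℝ E]
    [FiniteDimensional ℝ E] [MeasurableSpace E] [BorelSpace E] {μ : Measure E}
    [μ.IsAddHaarMeasure] {ε : ℝ} (hε : 0 < ε) {φ : E → E} (hφ : Differentiable ℝ φ)
    (hbij : Function.Bijective φ) (hdet : ∀ x, ε ≤ (fderiv ℝ φ x).det) {g : E → ℝ}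
    (hg : Integrable g μ) {h : E → ℝ} (h0 : ∀ x, 0 ≤ h x) (hg0 : ∀ x, 0 ≤ g x)
    (hle : ∀ x, h x ≤ g (φ x)) :
    ∫ x, h x ∂μ ≤ ε⁻¹ * ∫ x, g x ∂μ := by
  have hder : ∀ x ∈ Set.univ, HasFDerivWithinAt φ (fderiv ℝ φ x) Set.univ x :=
    fun x _ => (hφ x).hasFDerivAt.hasFDerivWithinAt
  have himg : φ '' Set.univ = Set.univ := by simpa using hbij.surjective.range_eq
  have hint := (integrableOn_image_iff_integrableOn_abs_det_fderiv_smul μ MeasurableSet.univ hder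
    hbij.injective.injOn g).1 (by rw [himg]; exact hg.integrableOn)
  have heq := integral_image_eq_integral_abs_det_fderiv_smul μ MeasurableSet.univ hder
    hbij.injective.injOn g
  rw [himg] at heq
  simp only [Measure.restrict_univ, integrableOn_univ] at heq hint
  rw [heq, ← integral_const_mul]
  refine integral_mono_of_nonneg (Eventually.of_forall h0) (hint.const_mul _)
    (Eventually.of_forall fun x => ?_)
  have h1 : 1 ≤ ε⁻¹ * |(fderiv ℝ φ x).det| := by
    rw [← div_eq_inv_mul, le_div_iff₀ hε, one_mul]
    exact (hdet x).trans (le_abs_self _)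
  calc h x ≤ g (φ x) := hle x
    _ ≤ (ε⁻¹ * |(fderiv ℝ φ x).det|) * g (φ x) := le_mul_of_one_le_left (hg0 _) h1
    _ = _ := mul_assoc _ _ _

lemma rpow_inv_sum_le {ι : Type*} (s : Finset ι) {a : ι → ℝ} (ha : ∀ i, 0 ≤ a i) {p : ℝ}
    (hp : 1 < p) : (∑ i ∈ s, a i) ^ (1 / p) ≤ (s.card : ℝ) ^ (1 / p) * ∑ i ∈ s, a i ^ (1 / p) := by
  have hp0 : 0 < p := by linarith
  set S := ∑ i ∈ s, a i ^ (1 / p) with hS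
  have hS0 : 0 ≤ S := Finset.sum_nonneg fun i _ => Real.rpow_nonneg (ha i) _
  have h : ∑ i ∈ s, a i ≤ s.card * S ^ p := by
    refine (Finset.sum_le_card_nsmul _ _ (S ^ p) fun i hi => ?_).trans_eq (nsmul_eq_mul _ _)
    have : a i ^ (1 / p) ≤ S := Finset.single_le_sum (f := fun i => a i ^ (1 / p))
      (fun i _ => Real.rpow_nonneg (ha i) _) hi
    calc a i = (a i ^ (1 / p)) ^ p := by
          rw [← Real.rpow_mul (ha i), one_div_mul_cancel hp0.ne', Real.rpow_one]
      _ ≤ S ^ p := Real.rpow_le_rpow (Real.rpow_nonneg (ha i) _) this hp0.le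
  calc _ ≤ (s.card * S ^ p) ^ (1 / p) :=
        Real.rpow_le_rpow (Finset.sum_nonneg fun i _ => ha i) h (by positivity)
    _ = _ := by
        rw [Real.mul_rpow (by positivity) (by positivity), ← Real.rpow_mul hS0,
          mul_one_div_cancel hp0.ne', Real.rpow_one]

/-- Boundedness of composition with an asymptotic-type diffeomorphism
`φ = Id + u` on the weighted Sobolev spaces `H^{k,p}_δ(ℝ^d)`, `0 ≤ k ≤ m`:
`‖f ∘ φ‖_{H^{k,p}_δ} ≤ C ‖f‖_{H^{k,p}_δ}` for `f ∈ C_c^∞(ℝ^d)`, with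
`C = C(d,m,p,δ,K,ε)`. -/
theorem composition_bound_H
    (d m : ℕ) (hd : 1 ≤ d) (p δ K ε : ℝ) (hp : 1 < p)
    (hm : 1 + (d : ℝ) / p < (m : ℝ)) (hK : 1 ≤ K) (hε : 0 < ε) :
    ∃ C : ℝ, 0 < C ∧
      ∀ u : EuclideanSpace ℝ (Fin d) → EuclideanSpace ℝ (Fin d),
        ContDiff ℝ m (fun x => x + u x) →
        Function.Bijective (fun x => x + u x) →
        ContDiff ℝ m (Function.invFun (fun x => x + u x)) →
        (∀ α ∈ mIdx d m, ∀ x, ‖mD α u x‖ ≤ K) →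
        (∀ x, ε ≤ (fderiv ℝ (fun x => x + u x) x).det) →
        ∀ f : EuclideanSpace ℝ (Fin d) → ℝ, ContDiff ℝ (⊤ : ℕ∞) f → HasCompactSupport f →
        ∀ k : ℕ, k ≤ m →
          ∑ α ∈ mIdx d k,
              (∫ x, (jb x ^ δ * |mD α (fun y => f (y + u y)) x|) ^ p) ^ (1 / p) ≤
            C * ∑ α ∈ mIdx d k, (∫ x, (jb x ^ δ * |mD α f x|) ^ p) ^ (1 / p) := by
  have hp0 : 0 < p := by linarith
  have hm1 : 1 ≤ m := by
    have : (0 : ℝ) ≤ d / p := by positivity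
    have : (1 : ℝ) < m := by linarith
    exact_mod_cast this.le
  obtain ⟨A, hA, hchain⟩ := exists_abs_mD_comp_le d m hK
  set W : ℝ := (1 + K) ^ |δ| with hW
  have hW0 : 0 < W := by positivity
  set N : ℝ := ((mIdx d m).card : ℝ) with hN
  have hN0 : 0 < N := by
    rw [hN]
    exact_mod_cast Finset.card_pos.2 ⟨0, mem_mIdx.2 (by simp [msize])⟩
  set T : ℝ := ε⁻¹ * ((W * A) ^ p * N ^ (p - 1)) with hT
  have hT0 : 0 < T := by positivity
  refine ⟨N * (T ^ (1 / p) * N ^ (1 / p)), by positivity, ?_⟩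
  intro u hφ hbij _ hbd hdet f hf hfc k hk
  have hu : ContDiff ℝ m u := by
    simpa using hφ.sub contDiff_id
  have hfn : ∀ n : ℕ, ContDiff ℝ n f := fun n => hf.of_le (by exact_mod_cast le_top)
  have hu0 : ∀ x, ‖u x‖ ≤ K := by
    intro x
    have h := hbd 0 (mem_mIdx.2 (by simp [msize])) x
    have h0 : mD 0 u = u := by
      have : dirs (0 : Fin d → ℕ) = [] := List.eq_nil_of_length_eq_zero
        (by rw [length_dirs]; simp [msize])
      change pdList (dirs 0) u = u
      rw [this]
      rfl
    rwa [h0] at h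
  set G : (Fin d → ℕ) → EuclideanSpace ℝ (Fin d) → ℝ :=
    fun β x => (jb x ^ δ * |mD β f x|) ^ p with hG
  have hG0 : ∀ β x, 0 ≤ G β x := fun β x =>
    Real.rpow_nonneg (mul_nonneg (Real.rpow_nonneg (jb_pos x).le _) (abs_nonneg _)) _
  have hGint : ∀ β, Integrable (G β) := by
    intro β
    refine Continuous.integrable_of_hasCompactSupport ?_ ?_
    · refine Continuous.rpow_const (Continuous.mul ?_ ?_) fun _ => Or.inr hp0.le
      · exact continuous_jb.rpow_const fun x => Or.inl (jb_pos x).ne'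
      · exact (continuous_mD (hfn (msize β)) le_rfl).abs
    · refine (hasCompactSupport_mD hfc β).mono fun x hx => ?_
      contrapose! hx
      simp only [Function.mem_support, not_not] at hx ⊢
      simp [hG, hx, Real.zero_rpow hp0.ne']
  have hcard : ((mIdx d k).card : ℝ) ≤ N := by
    rw [hN]
    exact_mod_cast Finset.card_le_card (mIdx_mono hk)
  have hterm : ∀ α ∈ mIdx d k,
      (∫ x, (jb x ^ δ * |mD α (fun y => f (y + u y)) x|) ^ p) ^ (1 / p) ≤
        T ^ (1 / p) * N ^ (1 / p) * ∑ β ∈ mIdx d k, (∫ x, G β x) ^ (1 / p) := by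
    intro α hα
    have hpt : ∀ x, (jb x ^ δ * |mD α (fun y => f (y + u y)) x|) ^ p ≤
        (W * A) ^ p * N ^ (p - 1) * ∑ β ∈ mIdx d k, G β (x + u x) := by
      intro x
      have hj := jb_pos x
      have hj' : 0 < jb (x + u x) ^ δ := Real.rpow_pos_of_pos (jb_pos _) _
      have h1 : jb x ^ δ * |mD α (fun y => f (y + u y)) x| ≤
          (W * A) * ∑ β ∈ mIdx d k, jb (x + u x) ^ δ * |mD β f (x + u x)| := by
        calc _ ≤ (W * jb (x + u x) ^ δ) * (A * ∑ β ∈ mIdx d k, |mD β f (x + u x)|) :=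
              mul_le_mul (jb_rpow_le δ (hu0 x)) (hchain u hu hbd f (hfn m) k hk α hα x)
                (abs_nonneg _) (by positivity)
          _ = _ := by rw [← Finset.mul_sum]; ring
      calc _ ≤ ((W * A) * ∑ β ∈ mIdx d k, jb (x + u x) ^ δ * |mD β f (x + u x)|) ^ p :=
            Real.rpow_le_rpow (by positivity) h1 hp0.le
        _ = (W * A) ^ p * (∑ β ∈ mIdx d k, jb (x + u x) ^ δ * |mD β f (x + u x)|) ^ p :=
            Real.mul_rpow (by positivity) (by positivity)
        _ ≤ (W * A) ^ p * (N ^ (p - 1) * ∑ β ∈ mIdx d k, G β (x + u x)) := by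
            refine mul_le_mul_of_nonneg_left ?_ (by positivity)
            refine (Real.rpow_sum_le_const_mul_sum_rpow_of_nonneg _ hp.le
              fun β _ => by positivity).trans ?_
            refine mul_le_mul_of_nonneg_right ?_ (Finset.sum_nonneg fun β _ => hG0 β _)
            exact Real.rpow_le_rpow (by positivity) hcard (by linarith)
        _ = _ := by ring
    have hI := integral_comp_le_of_le_det (μ := volume) hε
      (hφ.differentiable (by exact_mod_cast (by omega : m ≠ 0))) hbij hdet
      (g := fun y => (W * A) ^ p * N ^ (p - 1) * ∑ β ∈ mIdx d k, G β y)
      ((integrable_finsetSum _ fun β _ => hGint β).const_mul _)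
      (fun x => Real.rpow_nonneg (mul_nonneg (Real.rpow_nonneg (jb_pos x).le _) (abs_nonneg _)) _)
      (fun y => mul_nonneg (by positivity) (Finset.sum_nonneg fun β _ => hG0 β y)) hpt
    rw [integral_const_mul, integral_finsetSum _ fun β _ => hGint β, ← mul_assoc, ← hT] at hI
    have hI0 : ∀ β, 0 ≤ ∫ x, G β x := fun β => integral_nonneg (hG0 β)
    have hS0 : 0 ≤ ∑ β ∈ mIdx d k, (∫ x, G β x) ^ (1 / p) :=
      Finset.sum_nonneg fun β _ => Real.rpow_nonneg (hI0 β) _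
    calc _ ≤ (T * ∑ β ∈ mIdx d k, ∫ x, G β x) ^ (1 / p) := by
          refine Real.rpow_le_rpow (integral_nonneg fun x => ?_) hI (by positivity)
          exact Real.rpow_nonneg (mul_nonneg (Real.rpow_nonneg (jb_pos x).le _) (abs_nonneg _)) _
      _ = T ^ (1 / p) * (∑ β ∈ mIdx d k, ∫ x, G β x) ^ (1 / p) :=
          Real.mul_rpow hT0.le (Finset.sum_nonneg fun β _ => hI0 β)
      _ ≤ T ^ (1 / p) * (N ^ (1 / p) * ∑ β ∈ mIdx d k, (∫ x, G β x) ^ (1 / p)) := by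
          refine mul_le_mul_of_nonneg_left ((rpow_inv_sum_le _ hI0 hp).trans ?_) (by positivity)
          refine mul_le_mul_of_nonneg_right ?_ hS0
          exact Real.rpow_le_rpow (by positivity) hcard (by positivity)
      _ = _ := by ring
  have hS0 : 0 ≤ ∑ β ∈ mIdx d k, (∫ x, G β x) ^ (1 / p) :=
    Finset.sum_nonneg fun β _ => Real.rpow_nonneg (integral_nonneg (hG0 β)) _
  refine (Finset.sum_le_card_nsmul _ _ _ hterm).trans ?_
  rw [nsmul_eq_mul, ← mul_assoc]
  refine mul_le_mul_of_nonneg_right (mul_le_mul_of_nonneg_right hcard (by positivity)) hS0
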